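/- arXiv:1311.2210 — 2 statements merged into one kernel-verified Lean document; each statement's English description precedes it below -/
import Mathlib

section
/- If G is a connected r-regular graph (r ≥ 2) with χ'(G) = r and |E(G)| even, then its line graph L(G) satisfies χ'(L(G)) = 2r − 2. -/
open scoped Classical

structure Multigraph (V E : Type) where
  ends : E → Sym2 V
  not_isDiag : ∀ e, ¬ (ends e).IsDiag

namespace Multigraph

variable {V E : Type}

noncomputable def degree [Fintype E] (G : Multigraph V E) (v : V) : ℕ :=
  (Finset.univ.filter (fun e => v ∈ G.ends e)).card

def Proper (G : Multigraph V E) (c : E → ℕ) : Prop :=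
  ∀ e f, e ≠ f → ∀ v, v ∈ G.ends e → v ∈ G.ends f → c e ≠ c f

noncomputable def colorSet [Fintype E] (G : Multigraph V E) (c : E → ℕ) (v : V) : Finset ℕ :=
  (Finset.univ.filter (fun e => v ∈ G.ends e)).image c

def IsIntervalColoring [Fintype E] (G : Multigraph V E) (c : E → ℕ) (t : ℕ) : Prop :=
  G.Proper c ∧ (∀ e, c e ∈ Finset.Icc 1 t) ∧ (∀ i ∈ Finset.Icc 1 t, ∃ e, c e = i) ∧
    ∀ v : V, ∃ a b : ℕ, G.colorSet c v = Finset.Icc a b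

def IntervalColorable [Fintype E] (G : Multigraph V E) : Prop :=
  ∃ t c, G.IsIntervalColoring c t

def Adj (G : Multigraph V E) (v w : V) : Prop := ∃ e, G.ends e = s(v, w)

def Connected (G : Multigraph V E) : Prop :=
  Nonempty V ∧ ∀ v w : V, Relation.ReflTransGen G.Adj v w

noncomputable def maxDegree [Fintype V] [Fintype E] (G : Multigraph V E) : ℕ :=
  Finset.univ.sup G.degree

noncomputable def chromIndex [Fintype E] (G : Multigraph V E) : ℕ :=
  sInf {n | ∃ c : E → ℕ, G.Proper c ∧ ∀ e, c e ∈ Finset.Icc 1 n}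

end Multigraph

namespace Multigraph

variable {V E : Type}

/-- The multigraph obtained by subdividing the edge `e` (with endpoints `x` and `y`). -/
def subdivide (G : Multigraph V E) (e : E) (x y : V) :
    Multigraph (V ⊕ Unit) ({f : E // f ≠ e} ⊕ Bool) where
  ends := fun f => match f with
    | Sum.inl f => (G.ends f.1).map Sum.inl
    | Sum.inr true => s(Sum.inl x, Sum.inr ())
    | Sum.inr false => s(Sum.inl y, Sum.inr ())
  not_isDiag := by
    rintro (⟨f, hf⟩ | b)
    · exact fun h => G.not_isDiag f ((Sym2.isDiag_map Sum.inl_injective).mp h)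
    · cases b <;> simp

/-- The multigraph `G*`: a new vertex joined to every vertex of odd degree. -/
def addOddVertex [Fintype E] (G : Multigraph V E) :
    Multigraph (V ⊕ Unit) (E ⊕ {v : V // Odd (G.degree v)}) where
  ends := fun f => match f with
    | Sum.inl e => (G.ends e).map Sum.inl
    | Sum.inr v => s(Sum.inl v.1, Sum.inr ())
  not_isDiag := by
    rintro (e | v)
    · exact fun h => G.not_isDiag e ((Sym2.isDiag_map Sum.inl_injective).mp h)
    · simp

/-- The edge "names" of the line graph of `G`. -/
def LineEdges (G : Multigraph V E) : Type :=
  {p : Sym2 E // ¬p.IsDiag ∧ ∃ v : V, ∀ f, f ∈ p → v ∈ G.ends f}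

noncomputable instance [Finite E] (G : Multigraph V E) : Fintype G.LineEdges := by
  unfold Multigraph.LineEdges; exact Fintype.ofFinite _

/-- The line graph of `G`, as a multigraph on vertex set `E`. -/
def lineGraph (G : Multigraph V E) : Multigraph E G.LineEdges where
  ends := fun p => p.1
  not_isDiag := fun p => p.2.1

end Multigraph

namespace Jaeger

/-- number of ones before `i` -/
def oo (b : ℕ → ℕ) (i : ℕ) : ℤ := ∑ j ∈ Finset.range i, (b j : ℤ)

/-- the round-robin time at which `i` and `j` meet (modulo `2 * M`) -/
def T (b : ℕ → ℕ) (M i j : ℕ) : ℤ :=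
  if j = M then (if b i = 0 then 2 * ((i : ℤ) - oo b i) + oo b M else 2 * oo b i - oo b M)
  else if i = M then
    (if b j = 0 then 2 * ((j : ℤ) - oo b j) + oo b M else 2 * oo b j - oo b M)
  else if b i = 0 then
    (if b j = 0 then ((i : ℤ) - oo b i) + ((j : ℤ) - oo b j) + oo b M
      else oo b j + ((i : ℤ) - oo b i) + if j < i then (M : ℤ) else 0)
  else
    (if b j = 0 then oo b i + ((j : ℤ) - oo b j) + (if i < j then (M : ℤ) else 0)
      else oo b i + oo b j - oo b M)

/-- the offset of the meeting time inside the window of `i` -/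
def off (b : ℕ → ℕ) (M i j : ℕ) : ℤ :=
  if b i = 0 then
    (if j = M then ((i : ℤ) - oo b i) + oo b M - oo b i
      else if b j = 0 then ((j : ℤ) - oo b j) + oo b M - oo b i
      else if i < j then oo b j - oo b i else M + oo b j - oo b i)
  else
    (if j = M then M - ((i : ℤ) - oo b i) - oo b M + oo b i
      else if b j = 0 then
        (if j < i then M + ((j : ℤ) - oo b j) - ((i : ℤ) - oo b i)
          else ((j : ℤ) - oo b j) - ((i : ℤ) - oo b i))
      else M - ((i : ℤ) - oo b i) - oo b M + oo b j)

theorem T_symm (b : ℕ → ℕ) (M i j : ℕ) : T b M i j = T b M j i := by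
  by_cases h : i = j
  · rw [h]
  unfold T
  split_ifs <;> omega

theorem oo_lt (b : ℕ → ℕ) (hb : ∀ i, b i ≤ 1) {i j : ℕ} (h : i < j) :
    oo b i + b i ≤ oo b j ∧ oo b j - oo b i - b i ≤ j - i - 1 := by
  induction j, h using Nat.le_induction with
  | base => simp [oo, Finset.sum_range_succ]
  | succ n hn ih =>
    have h1 : oo b (n+1) = oo b n + b n := by simp [oo, Finset.sum_range_succ]
    have := hb n
    rw [h1]
    push_cast
    omega

theorem oo_bd (b : ℕ → ℕ) (hb : ∀ i, b i ≤ 1) (j : ℕ) :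
    0 ≤ oo b j ∧ oo b j ≤ j := by
  rcases Nat.eq_zero_or_pos j with h | h
  · subst h; simp [oo]
  · have := oo_lt b hb h
    have h0 : oo b 0 = 0 := by simp [oo]
    have := hb 0
    push_cast at *
    omega

theorem T_off (b : ℕ → ℕ) (hb : ∀ i, b i ≤ 1) (M i j : ℕ) (hi : i < M) (hj : j ≤ M)
    (hij : i ≠ j) : ∃ k : ℤ, T b M i j = i + M * b i + off b M i j + 2 * M * k := by
  have hbi : b i = 0 ∨ b i = 1 := by have := hb i; omega
  unfold T off
  rcases hbi with h | h <;> simp only [h] <;> split_ifs <;>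
  first
  | (exfalso; omega)
  | (refine ⟨0, ?_⟩; push_cast; linarith)
  | (refine ⟨-1, ?_⟩; push_cast; linarith)

theorem off_bd (b : ℕ → ℕ) (hb : ∀ i, b i ≤ 1) (M i j : ℕ) (hi : i < M) (hj : j ≤ M)
    (hij : i ≠ j) : 0 ≤ off b M i j ∧ off b M i j < M := by
  have hbi := hb i
  have hbj := hb j
  have h1 := oo_bd b hb i
  have h2 := oo_bd b hb j
  have h3 := oo_bd b hb M
  have h4 := oo_lt b hb hi
  have h5 : j < M → _ := fun h => oo_lt b hb h
  have h6 : j < i → _ := fun h => oo_lt b hb h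
  have h7 : i < j → _ := fun h => oo_lt b hb h
  unfold off
  split_ifs <;> omega

theorem off_inj (b : ℕ → ℕ) (hb : ∀ i, b i ≤ 1) (M i j k : ℕ) (hi : i < M) (hj : j ≤ M)
    (hk : k ≤ M) (hij : i ≠ j) (hik : i ≠ k) (hjk : j < k) : off b M i j ≠ off b M i k := by
  have hbi := hb i
  have hbj := hb j
  have hbk := hb k
  have h1 := oo_bd b hb i
  have h2 := oo_bd b hb j
  have h2' := oo_bd b hb k
  have h3 := oo_bd b hb M
  have h4 := oo_lt b hb hi
  have h5 : j < M → _ := fun h => oo_lt b hb h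
  have h5' : k < M → _ := fun h => oo_lt b hb h
  have h6 : j < i → _ := fun h => oo_lt b hb h
  have h6' : k < i → _ := fun h => oo_lt b hb h
  have h7 : i < j → _ := fun h => oo_lt b hb h
  have h7' : i < k → _ := fun h => oo_lt b hb h
  have h8 := oo_lt b hb hjk
  unfold off
  split_ifs <;> omega

/-- the label of `j` in the queue -/
def lab (b : ℕ → ℕ) (M j : ℕ) : ℤ :=
  if b j = 0 then (j : ℤ) - oo b j else M - oo b M + oo b j

theorem T_lab (b : ℕ → ℕ) (M j : ℕ) (hj : j < M) :
    ∃ k : ℤ, T b M M j = oo b M + 2 * lab b M j + 2 * M * k := by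
  unfold T lab
  split_ifs <;>
  first
  | omega
  | (refine ⟨0, ?_⟩; omega)
  | (refine ⟨-1, ?_⟩; omega)

theorem lab_bd (b : ℕ → ℕ) (hb : ∀ i, b i ≤ 1) (M j : ℕ) (hj : j < M) :
    0 ≤ lab b M j ∧ lab b M j < M := by
  have hbj := hb j
  have h2 := oo_bd b hb j
  have h3 := oo_bd b hb M
  have h4 := oo_lt b hb hj
  unfold lab
  split_ifs <;> omega

theorem lab_inj (b : ℕ → ℕ) (hb : ∀ i, b i ≤ 1) (M j k : ℕ) (hk : k < M) (hjk : j < k) :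
    lab b M j ≠ lab b M k := by
  have hbj := hb j
  have hbk := hb k
  have h2 := oo_bd b hb j
  have h2' := oo_bd b hb k
  have h3 := oo_bd b hb M
  have h4 := oo_lt b hb (hjk.trans hk)
  have h4' := oo_lt b hb hk
  have h5 := oo_lt b hb hjk
  unfold lab
  split_ifs <;> omega

theorem eq_of_dvd_of_lt (x y q K : ℤ) (h : x - y = K * q) (h1 : x - y < K) (h2 : y - x < K) :
    x = y := by
  have : x - y = 0 := by
    apply Int.eq_zero_of_abs_lt_dvd (m := K) ⟨q, h⟩
    rw [abs_lt]; omega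
  omega

theorem T_inj_lt (b : ℕ → ℕ) (hb : ∀ i, b i ≤ 1) (M i j k : ℕ) (hi : i ≤ M) (hj : j ≤ M)
    (hk : k ≤ M) (hij : i ≠ j) (hik : i ≠ k) (hjk : j < k) :
    T b M i j % (2 * M) ≠ T b M i k % (2 * M) := by
  intro h
  obtain ⟨q, hq⟩ := (Int.ModEq.dvd (show T b M i j ≡ T b M i k [ZMOD 2 * M] from h))
  rcases Nat.lt_or_ge i M with h' | h'
  · obtain ⟨k1, e1⟩ := T_off b hb M i j h' hj hij
    obtain ⟨k2, e2⟩ := T_off b hb M i k h' hk hik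
    have b1 := off_bd b hb M i j h' hj hij
    have b2 := off_bd b hb M i k h' hk hik
    apply off_inj b hb M i j k h' hj hk hij hik hjk
    symm
    apply eq_of_dvd_of_lt _ _ (q + k1 - k2) (2 * M)
    · linear_combination hq - e2 + e1
    · omega
    · omega
  · obtain rfl : i = M := by omega
    have hj' : j < i := by omega
    have hk' : k < i := by omega
    obtain ⟨k1, e1⟩ := T_lab b i j hj'
    obtain ⟨k2, e2⟩ := T_lab b i k hk'
    have b1 := lab_bd b hb i j hj'
    have b2 := lab_bd b hb i k hk'
    apply lab_inj b hb i j k hk' hjk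
    have : 2 * lab b i k = 2 * lab b i j := by
      apply eq_of_dvd_of_lt _ _ (q + k1 - k2) (2 * i)
      · linear_combination hq - e2 + e1
      · omega
      · omega
    omega

theorem T_inj (b : ℕ → ℕ) (hb : ∀ i, b i ≤ 1) (M i j k : ℕ) (hi : i ≤ M) (hj : j ≤ M)
    (hk : k ≤ M) (hij : i ≠ j) (hik : i ≠ k) (hjk : j ≠ k) :
    T b M i j % (2 * M) ≠ T b M i k % (2 * M) := by
  rcases Nat.lt_or_gt_of_ne hjk with h | h
  · exact T_inj_lt b hb M i j k hi hj hk hij hik h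
  · exact (T_inj_lt b hb M i k j hi hk hj hik hij h).symm

/-- complementary palettes at the two ends of an edge -/
theorem T_disj (b b' : ℕ → ℕ) (hb : ∀ i, b i ≤ 1) (hb' : ∀ i, b' i ≤ 1) (M i j k : ℕ)
    (hM : Even (oo b M + b M)) (hM' : Even (oo b' M + b' M))
    (hi : i ≤ M) (hj : j ≤ M)
    (hk : k ≤ M) (hij : i ≠ j) (hik : i ≠ k) (h0 : b i = 0) (h1 : b' i = 1) :
    T b M i j % (2 * M) ≠ T b' M i k % (2 * M) := by
  intro h
  obtain ⟨q, hq⟩ := (Int.ModEq.dvd (show T b M i j ≡ T b' M i k [ZMOD 2 * M] from h))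
  rcases Nat.lt_or_ge i M with h' | h'
  · obtain ⟨k1, e1⟩ := T_off b hb M i j h' hj hij
    obtain ⟨k2, e2⟩ := T_off b' hb' M i k h' hk hik
    have b1 := off_bd b hb M i j h' hj hij
    have b2 := off_bd b' hb' M i k h' hk hik
    rw [h0] at e1
    rw [h1] at e2
    push_cast at e1 e2
    have : (M : ℤ) + off b' M i k = off b M i j := by
      apply eq_of_dvd_of_lt _ _ (q + k1 - k2) (2 * M)
      · linear_combination hq - e2 + e1
      · omega
      · omega
    omega
  · obtain rfl : i = M := by omega
    obtain ⟨k1, e1⟩ := T_lab b i j (by omega)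
    obtain ⟨k2, e2⟩ := T_lab b' i k (by omega)
    rw [h0] at hM
    rw [h1] at hM'
    obtain ⟨a, ha⟩ := hM
    obtain ⟨a', ha'⟩ := hM'
    push_cast at ha ha'
    have : 2 * (a' - a + lab b' i k - lab b i j + i * k2 - i * k1 - i * q) = 1 := by
      linear_combination hq - e2 + e1 - ha' + ha
    omega

end Jaeger

namespace Jaeger

/-- the parity vectors of head assignments -/
def Ach {V E : Type} [Fintype E] (G : Multigraph V E) (p : V → ZMod 2) : Prop :=
  ∃ h : E → V, (∀ e, h e ∈ G.ends e) ∧ ∑ e, Pi.single (h e) (1 : ZMod 2) = p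

theorem two_fun {V : Type} (f : V → ZMod 2) : f + f = 0 := by
  funext v
  have : ∀ a : ZMod 2, a + a = 0 := by decide
  exact this (f v)

theorem ach_adj {V E : Type} [Fintype E] (G : Multigraph V E) (p : V → ZMod 2) (w x : V)
    (hp : Ach G p) (hwx : G.Adj w x) :
    Ach G (p + (Pi.single w 1 + Pi.single x 1)) := by
  obtain ⟨h, h1, h2⟩ := hp
  obtain ⟨e, he⟩ := hwx
  have key : ∀ y, y ∈ G.ends e → Ach G (p + (Pi.single (h e) 1 + Pi.single y 1)) := by
    intro y hy
    refine ⟨Function.update h e y, ?_, ?_⟩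
    · intro e'
      by_cases h' : e' = e
      · subst h'; simpa using hy
      · simpa [h'] using h1 e'
    · rw [← h2, ← Finset.add_sum_erase _ _ (Finset.mem_univ e),
        ← Finset.add_sum_erase Finset.univ (fun e => (Pi.single (h e) 1 : V → ZMod 2))
          (Finset.mem_univ e)]
      have : ∑ x ∈ Finset.univ.erase e, (Pi.single (Function.update h e y x) 1 : V → ZMod 2)
          = ∑ x ∈ Finset.univ.erase e, (Pi.single (h x) 1 : V → ZMod 2) := by
        apply Finset.sum_congr rfl
        intro x hx
        rw [Function.update_of_ne (Finset.ne_of_mem_erase hx)]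
      rw [this, Function.update_self]
      have := two_fun (Pi.single (h e) (1 : ZMod 2))
      linear_combination - this
  have hh := h1 e
  rw [he, Sym2.mem_iff] at hh
  rcases hh with hh | hh
  · have := key x (by rw [he]; simp)
    rwa [hh] at this
  · have := key w (by rw [he]; simp)
    rw [hh] at this
    rwa [add_comm (Pi.single w 1)]

theorem ach_path {V E : Type} [Fintype E] (G : Multigraph V E) (w x : V)
    (hwx : Relation.ReflTransGen G.Adj w x) : ∀ (p : V → ZMod 2) (_ : Ach G p),
    Ach G (p + (Pi.single w 1 + Pi.single x 1)) := by
  induction hwx with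
  | refl => intro p hp; rw [two_fun, add_zero]; exact hp
  | tail _ hb ih =>
    rename_i y z _
    intro p hp
    have := ach_adj G _ _ _ (ih p hp) hb
    convert this using 1
    have := two_fun (Pi.single y (1 : ZMod 2))
    linear_combination - this

theorem ach_set {V E : Type} [Fintype E] (G : Multigraph V E) (hc : G.Connected) (v0 : V)
    (p : V → ZMod 2) (hp : Ach G p) (S : Finset V) :
    Ach G (p + ∑ v ∈ S, (Pi.single v 1 + Pi.single v0 1)) := by
  induction S using Finset.induction_on with
  | empty => simpa using hp
  | insert a S ha ih =>
    rw [Finset.sum_insert ha]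
    have := ach_path G a v0 (hc.2 a v0) _ ih
    convert this using 1
    ring

theorem even_heads {V E : Type} [Fintype V] [Fintype E] (G : Multigraph V E) (hc : G.Connected)
    (heven : Even (Fintype.card E)) :
    ∃ h : E → V, (∀ e, h e ∈ G.ends e) ∧
      ∀ v, Even (Finset.univ.filter (fun e => h e = v)).card := by
  obtain ⟨v0⟩ := hc.1
  have hE : ((Fintype.card E : ℕ) : ZMod 2) = 0 := by
    rwa [ZMod.natCast_eq_zero_iff_even]
  have h0 : Ach G 0 := by
    let h : E → V := fun e => (G.ends e).out.1
    have hh : ∀ e, h e ∈ G.ends e := fun e => Sym2.out_fst_mem _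
    let p : V → ZMod 2 := ∑ e, Pi.single (h e) (1 : ZMod 2)
    have hp : Ach G p := ⟨h, hh, rfl⟩
    have hsum : ∑ v, p v = 0 := by
      simp only [p, Finset.sum_apply]
      rw [Finset.sum_comm]
      simpa [Pi.single_apply] using hE
    have h01 : ∀ a : ZMod 2, a ≠ 0 → a = 1 := by decide
    have hpS : p = ∑ v ∈ Finset.univ.filter (fun v => p v ≠ 0), Pi.single v (1 : ZMod 2) := by
      funext w
      rw [Finset.sum_apply]
      simp only [Pi.single_apply, Finset.sum_ite_eq, Finset.mem_filter, Finset.mem_univ, true_and]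
      split_ifs with hw
      · exact h01 _ hw
      · simpa using hw
    have hcard : (((Finset.univ.filter (fun v => p v ≠ 0)).card : ℕ) : ZMod 2) = 0 := by
      refine Eq.trans ?_ hsum
      rw [Finset.card_filter]
      push_cast
      apply Finset.sum_congr rfl
      intro v _
      split_ifs with hw
      · exact (h01 _ hw).symm
      · exact (not_not.mp hw).symm
    have := ach_set G hc v0 p hp (Finset.univ.filter (fun v => p v ≠ 0))
    convert this using 1
    rw [Finset.sum_add_distrib, ← hpS, Finset.sum_const, ← add_assoc, two_fun, zero_add]
    funext w
    rw [Pi.smul_apply, nsmul_eq_mul, hcard, zero_mul]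
    rfl
  obtain ⟨h, h1, h2⟩ := h0
  refine ⟨h, h1, fun v => ?_⟩
  rw [← ZMod.natCast_eq_zero_iff_even, Finset.card_filter]
  have := congrFun h2 v
  rw [Finset.sum_apply] at this
  push_cast
  simpa [Pi.single_apply, eq_comm] using this

theorem lower {V E : Type} [Fintype V] [Fintype E] (G : Multigraph V E)
    (hsimple : Function.Injective G.ends) (r : ℕ) (hr : 2 ≤ r) (v0 : V)
    (hreg : ∀ v : V, G.degree v = r) (n : ℕ) (c : G.LineEdges → ℕ)
    (hc : G.lineGraph.Proper c) (hn : ∀ e, c e ∈ Finset.Icc 1 n) : 2 * r - 2 ≤ n := by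
  have hex : ∃ e, v0 ∈ G.ends e := by
    have h := hreg v0
    unfold Multigraph.degree at h
    have : 0 < (Finset.univ.filter (fun e => v0 ∈ G.ends e)).card := by omega
    obtain ⟨e, he⟩ := Finset.card_pos.mp this
    exact ⟨e, by simpa using he⟩
  obtain ⟨e, he⟩ := hex
  obtain ⟨x, hx⟩ := he
  have hne : v0 ≠ x := by
    have := G.not_isDiag e
    rw [hx] at this
    simpa using this
  let A : V → Finset E := fun v => (Finset.univ.filter (fun f => v ∈ G.ends f)).erase e
  have hA : ∀ v, v ∈ G.ends e → (A v).card = r - 1 := by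
    intro v hv
    have h := hreg v
    unfold Multigraph.degree at h
    simp only [A]
    rw [Finset.card_erase_of_mem (by simpa using hv), h]
  have hdis : Disjoint (A v0) (A x) := by
    rw [Finset.disjoint_left]
    intro f hf hf'
    simp only [A, Finset.mem_erase, Finset.mem_filter, Finset.mem_univ, true_and] at hf hf'
    apply hf.1
    apply hsimple
    rw [hx]
    exact (Sym2.mem_and_mem_iff hne).mp ⟨hf.2, hf'.2⟩
  have hB : ∀ f : E, f ∈ A v0 ∪ A x → ∃ p : G.LineEdges, p.1 = s(e, f) := by
    intro f hf
    have : f ≠ e ∧ ∃ v, v ∈ G.ends e ∧ v ∈ G.ends f := by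
      simp only [A, Finset.mem_union, Finset.mem_erase, Finset.mem_filter, Finset.mem_univ,
        true_and] at hf
      rcases hf with hf | hf
      · exact ⟨hf.1, v0, by rw [hx]; simp, hf.2⟩
      · exact ⟨hf.1, x, by rw [hx]; simp, hf.2⟩
    obtain ⟨h1, v, h2, h3⟩ := this
    refine ⟨⟨s(e, f), ?_, v, ?_⟩, rfl⟩
    · simpa using h1.symm
    · intro g hg
      rcases Sym2.mem_iff.mp hg with rfl | rfl <;> assumption
  have : Nonempty G.LineEdges := by
    have h1 := hA v0 (by rw [hx]; simp)
    have h2 : 0 < (A v0).card := by omega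
    obtain ⟨f, hf⟩ := Finset.card_pos.mp h2
    exact ⟨(hB f (Finset.mem_union_left _ hf)).choose⟩
  choose! φ hφ using hB
  have hle : (A v0 ∪ A x).card ≤ (Finset.Icc 1 n).card := by
    apply Finset.card_le_card_of_injOn (fun f => c (φ f))
    · intro f _
      exact hn _
    · intro f hf g hg hfg
      by_contra hne
      refine hc (φ f) (φ g) ?_ e ?_ ?_ hfg
      · intro h
        have h' := congrArg Subtype.val h
        rw [hφ f hf, hφ g hg] at h'
        exact hne (Sym2.congr_right.mp h')
      · show e ∈ (φ f).1
        rw [hφ f hf]; simp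
      · show e ∈ (φ g).1
        rw [hφ g hg]; simp
  rw [Finset.card_union_of_disjoint hdis, hA _ (by rw [hx]; simp), hA _ (by rw [hx]; simp),
    Nat.card_Icc] at hle
  omega

theorem upper {V E : Type} [Fintype V] [Fintype E] (G : Multigraph V E)
    (hconn : G.Connected) (M : ℕ) (hM : 1 ≤ M) (d : E → ℕ) (hd : G.Proper d)
    (hdM : ∀ e, d e ≤ M) (heven : Even (Fintype.card E)) :
    ∃ c : G.LineEdges → ℕ, G.lineGraph.Proper c ∧ ∀ e, c e ∈ Finset.Icc 1 (2 * M) := by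
  obtain ⟨h, hh, hev⟩ := even_heads G hconn heven
  let b : V → ℕ → ℕ := fun v i => if ∃ e, d e = i ∧ h e = v then 1 else 0
  have hb : ∀ v i, b v i ≤ 1 := by
    intro v i
    simp only [b]
    split_ifs <;> omega
  have hb1 : ∀ e, b (h e) (d e) = 1 := by
    intro e
    simp only [b]
    rw [if_pos ⟨e, rfl, rfl⟩]
  have hb0 : ∀ e v, v ∈ G.ends e → v ≠ h e → b v (d e) = 0 := by
    intro e v hv hne
    simp only [b]
    rw [if_neg]
    rintro ⟨f, hf, rfl⟩
    by_cases hfe : f = e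
    · subst hfe; exact hne rfl
    · exact hd f e hfe (h f) (hh f) hv hf
  have hpar : ∀ v, Even (oo (b v) M + b v M) := by
    intro v
    have h1 : oo (b v) M + b v M = ((Finset.univ.filter (fun e => h e = v)).card : ℤ) := by
      have h2 : (Finset.univ.filter (fun e => h e = v)).card
          = ((Finset.range (M + 1)).filter (fun i => ∃ e, d e = i ∧ h e = v)).card := by
        apply Finset.card_bij (fun e _ => d e)
        · intro e he
          have := hdM e
          simp only [Finset.mem_filter, Finset.mem_univ, true_and] at he
          simp only [Finset.mem_filter, Finset.mem_range]
          exact ⟨by omega, e, rfl, he⟩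
        · intro e he f hf hef
          simp only [Finset.mem_filter, Finset.mem_univ, true_and] at he hf
          by_contra hne
          exact hd e f hne v (he ▸ hh e) (hf ▸ hh f) hef
        · intro i hi
          simp only [Finset.mem_filter, Finset.mem_range] at hi
          obtain ⟨_, e, h3, h4⟩ := hi
          exact ⟨e, by simpa using h4, h3⟩
      rw [h2, Finset.card_filter]
      unfold oo
      rw [← Finset.sum_range_succ (fun j => ((b v j : ℕ) : ℤ))]
      push_cast
      apply Finset.sum_congr rfl
      intro i _
      simp only [b]
      split_ifs <;> simp
    rw [h1]
    exact_mod_cast hev v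
  have hcol : ∀ p : G.LineEdges, ∃ n : ℤ, ∃ v, (∀ f, f ∈ p.1 → v ∈ G.ends f) ∧
      ∀ e f, p.1 = s(e, f) → n = T (b v) M (d e) (d f) % (2 * M) := by
    rintro ⟨p, hp, v, hv⟩
    induction p using Sym2.ind with
    | _ e f =>
      refine ⟨T (b v) M (d e) (d f) % (2 * M), v, hv, ?_⟩
      intro e' f' hef
      rcases Sym2.eq_iff.mp hef with ⟨rfl, rfl⟩ | ⟨rfl, rfl⟩
      · rfl
      · rw [T_symm]
  choose n w hw hn using hcol
  have hbd : ∀ p, 0 ≤ n p ∧ n p < 2 * M := by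
    intro p
    obtain ⟨e, f, hef⟩ : ∃ e f, p.1 = s(e, f) := by
      induction hp : p.1 using Sym2.ind with
      | _ e f => exact ⟨e, f, rfl⟩
    rw [hn p e f hef]
    exact ⟨Int.emod_nonneg _ (by omega), Int.emod_lt_of_pos _ (by omega)⟩
  refine ⟨fun p => (n p).toNat + 1, ?_, ?_⟩
  · intro p q hpq e hep heq hcc
    have hnn : n p = n q := by
      have h1 := hbd p
      have h2 := hbd q
      simp only at hcc
      omega
    obtain ⟨f, hf⟩ : ∃ f, p.1 = s(e, f) := hep
    obtain ⟨g, hg⟩ : ∃ g, q.1 = s(e, g) := heq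
    have hfg : f ≠ g := by
      rintro rfl
      exact hpq (Subtype.ext (hf.trans hg.symm))
    have hef : e ≠ f := by
      have := p.2.1
      rw [hf] at this
      simpa using this
    have heg : e ≠ g := by
      have := q.2.1
      rw [hg] at this
      simpa using this
    have pe := hw p e (by rw [hf]; simp)
    have pf := hw p f (by rw [hf]; simp)
    have qe := hw q e (by rw [hg]; simp)
    have qg := hw q g (by rw [hg]; simp)
    have c1 := hd e f hef _ pe pf
    have c2 := hd e g heg _ qe qg
    rw [hn p e f hf, hn q e g hg] at hnn
    by_cases hv : w p = w q
    · rw [hv] at hnn pf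
      exact T_inj (b (w q)) (hb _) M _ _ _ (hdM e) (hdM f) (hdM g) c1 c2
        (hd f g hfg _ pf qg) hnn
    · by_cases h1 : w p = h e
      · have z := hb0 e (w q) qe (fun h' => hv (h1.trans h'.symm))
        have o := hb1 e
        rw [← h1] at o
        exact T_disj _ _ (hb _) (hb _) M _ _ _ (hpar _) (hpar _) (hdM e) (hdM g) (hdM f) c2 c1
          z o hnn.symm
      · have h2 : w q = h e := by
          have h3 := (Sym2.mem_and_mem_iff hv).mp ⟨pe, qe⟩
          have h4 := hh e
          rw [h3, Sym2.mem_iff] at h4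
          rcases h4 with h4 | h4
          · exact absurd h4.symm h1
          · exact h4.symm
        have z := hb0 e (w p) pe h1
        have o := hb1 e
        rw [← h2] at o
        exact T_disj _ _ (hb _) (hb _) M _ _ _ (hpar _) (hpar _) (hdM e) (hdM f) (hdM g) c1 c2
          z o hnn
  · intro p
    have h1 := hbd p
    show (n p).toNat + 1 ∈ Finset.Icc 1 (2 * M)
    rw [Finset.mem_Icc]
    omega

end Jaeger

/-- Jaeger: if `G` is a connected `r`-regular simple graph (`r ≥ 2`) with
`χ'(G) = r` and `|E(G)|` even, then `χ'(L(G)) = 2r - 2`. -/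
theorem stmt13 {V E : Type} [Fintype V] [Fintype E] (G : Multigraph V E)
    (hsimple : Function.Injective G.ends) (hconn : G.Connected) (r : ℕ) (hr : 2 ≤ r)
    (hreg : ∀ v : V, G.degree v = r) (hchi : G.chromIndex = r)
    (heven : Even (Fintype.card E)) :
    G.lineGraph.chromIndex = 2 * r - 2 := by
  have hmem : r ∈ {n | ∃ c : E → ℕ, G.Proper c ∧ ∀ e, c e ∈ Finset.Icc 1 n} := by
    have hne : {n | ∃ c : E → ℕ, G.Proper c ∧ ∀ e, c e ∈ Finset.Icc 1 n}.Nonempty := by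
      rw [Set.nonempty_iff_ne_empty]
      intro h0
      unfold Multigraph.chromIndex at hchi
      rw [h0, Nat.sInf_empty] at hchi
      omega
    have := Nat.sInf_mem hne
    unfold Multigraph.chromIndex at hchi
    rwa [hchi] at this
  obtain ⟨c, hc, hcr⟩ := hmem
  have hcr' : ∀ e, 1 ≤ c e ∧ c e ≤ r := fun e => Finset.mem_Icc.mp (hcr e)
  have hup := Jaeger.upper G hconn (r - 1) (by omega) (fun e => c e - 1)
    (by
      intro e f hef v he hf
      have h1 := hcr' e
      have h2 := hcr' f
      have h3 := hc e f hef v he hf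
      show c e - 1 ≠ c f - 1
      omega)
    (by
      intro e
      have h1 := hcr' e
      show c e - 1 ≤ r - 1
      omega) heven
  rw [show 2 * (r - 1) = 2 * r - 2 by omega] at hup
  obtain ⟨v0⟩ := hconn.1
  unfold Multigraph.chromIndex
  apply le_antisymm
  · exact Nat.sInf_le hup
  · have hmem := Nat.sInf_mem (s := {n | ∃ c : G.LineEdges → ℕ,
      G.lineGraph.Proper c ∧ ∀ e, c e ∈ Finset.Icc 1 n}) ⟨_, hup⟩
    obtain ⟨c', hc', hn⟩ := hmem
    exact Jaeger.lower G hsimple r hr v0 hreg _ c' hc' hn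
end

section
/- If G is a connected r-regular graph (r ≥ 2) with an even number of edges that admits an interval coloring, then its line graph L(G) is a connected Eulerian graph with an even number of edges that also admits an interval coloring. -/
open scoped Classical

namespace JaegerAux

/-- Position of index `i` on the circle, given the flips `x`. -/
noncomputable def pos (N : ℕ) (x : ℕ → Prop) (i : ℕ) : ℕ :=
  if x i then (N - Nat.count x N) + Nat.count x i else i - Nat.count x i

noncomputable def rawcol (N : ℕ) (x : ℕ → Prop) (i j : ℕ) : ℕ :=
  pos N x i + pos N x j + Nat.count x N +
    (if (x i ↔ x j) then 0 else if (x i ∧ i < j) ∨ (x j ∧ j < i) then 0 else N)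

/-- Colour of the pair `i, j` in the local complete graph. -/
noncomputable def col (N : ℕ) (x : ℕ → Prop) (i j : ℕ) : ℕ :=
  if rawcol N x i j < 2 * N then rawcol N x i j else rawcol N x i j - 2 * N

lemma rawcol_symm (N : ℕ) (x : ℕ → Prop) (i j : ℕ) : rawcol N x i j = rawcol N x j i := by
  unfold rawcol
  have h1 : (x i ↔ x j) ↔ (x j ↔ x i) := by tauto
  have h2 : ((x i ∧ i < j) ∨ (x j ∧ j < i)) ↔ ((x j ∧ j < i) ∨ (x i ∧ i < j)) := by tauto
  simp only [h1, h2]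
  omega

lemma col_symm (N : ℕ) (x : ℕ → Prop) (i j : ℕ) : col N x i j = col N x j i := by
  unfold col
  rw [rawcol_symm]

lemma count_not_strict (x : ℕ → Prop) {i j : ℕ} (hi : ¬ x i) (hij : i < j) :
    Nat.count x j + i + 1 ≤ Nat.count x i + j := by
  have : ∀ d, Nat.count x (i + 1 + d) ≤ Nat.count x i + d := by
    intro d
    induction d with
    | zero => simp [Nat.count_succ, hi]
    | succ d ih =>
      rw [← add_assoc, Nat.count_succ]
      split_ifs <;> omega
  have h := this (j - (i + 1))
  rw [show i + 1 + (j - (i + 1)) = j by omega] at h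
  omega

lemma count_le_diff (x : ℕ → Prop) {i j : ℕ} (hij : i ≤ j) :
    Nat.count x j + i ≤ Nat.count x i + j := by
  obtain ⟨d, rfl⟩ := Nat.exists_eq_add_of_le hij
  rw [Nat.count_add]
  have : Nat.count (fun k => x (i + k)) d ≤ d := Nat.count_le _
  omega

lemma pos_lt (N : ℕ) (x : ℕ → Prop) {i : ℕ} (hi : i < N) : pos N x i < N := by
  unfold pos
  have h3 : Nat.count x N ≤ N := Nat.count_le _
  split_ifs with h
  · have := Nat.count_strict_mono h hi
    omega
  · omega

lemma pos_inj (N : ℕ) (x : ℕ → Prop) {i j : ℕ} (hi : i < N) (hj : j < N)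
    (h : pos N x i = pos N x j) : i = j := by
  by_contra hne
  wlog hlt : i < j generalizing i j
  · exact this hj hi h.symm (Ne.symm hne) (by omega)
  unfold pos at h
  have a1 : Nat.count x i ≤ i := Nat.count_le _
  have a2 : Nat.count x j ≤ j := Nat.count_le _
  have a3 : Nat.count x N ≤ N := Nat.count_le _
  split_ifs at h with h1 h2 h2
  · have := Nat.count_strict_mono h1 hlt
    omega
  · have := count_not_strict x h2 hj
    omega
  · have := count_not_strict x h1 hi
    omega
  · have := count_not_strict x h1 hlt
    omega

lemma rawcol_lt (N : ℕ) (x : ℕ → Prop) {i j : ℕ} (hi : i < N) (hj : j < N) :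
    rawcol N x i j < 4 * N := by
  have h1 := pos_lt N x hi
  have h2 := pos_lt N x hj
  have a3 : Nat.count x N ≤ N := Nat.count_le _
  unfold rawcol
  split_ifs <;> omega

lemma col_lt (N : ℕ) (x : ℕ → Prop) {i j : ℕ} (hi : i < N) (hj : j < N) :
    col N x i j < 2 * N := by
  have h1 := rawcol_lt N x hi hj
  unfold col
  split_ifs <;> omega

lemma col_inj (N : ℕ) (x : ℕ → Prop) {i j k : ℕ} (hj : j < N) (hk : k < N)
    (h : col N x i j = col N x i k) : j = k := by
  apply pos_inj N x hj hk
  have h2 := pos_lt N x hj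
  have h3 := pos_lt N x hk
  unfold col rawcol at h
  split_ifs at h <;> omega

lemma col_diag (N : ℕ) (x : ℕ → Prop) (i : ℕ) :
    col N x i i % 2 = Nat.count x N % 2 := by
  unfold col rawcol
  simp only [iff_self, if_true]
  split_ifs <;> omega

lemma col_diag_inj (N : ℕ) (x : ℕ → Prop) {j k : ℕ} (hj : j < N) (hk : k < N)
    (h : col N x j j = col N x k k) : j = k := by
  apply pos_inj N x hj hk
  have h2 := pos_lt N x hj
  have h3 := pos_lt N x hk
  unfold col rawcol at h
  simp only [iff_self, if_true] at h
  split_ifs at h <;> omega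

lemma col_mem (N : ℕ) (x : ℕ → Prop) {i j : ℕ} (hi : i < N) (hj : j < N) :
    (i ≤ col N x i j ∧ col N x i j < i + N) ↔ ¬ x i := by
  have a1 : Nat.count x i ≤ i := Nat.count_le _
  have a2 : Nat.count x j ≤ j := Nat.count_le _
  have a3 : Nat.count x N ≤ N := Nat.count_le _
  have m1 : Nat.count x i ≤ Nat.count x N := Nat.count_monotone x hi.le
  have m2 : Nat.count x j ≤ Nat.count x N := Nat.count_monotone x hj.le
  have d1 := count_le_diff x hi.le
  have d2 := count_le_diff x hj.le
  rcases lt_trichotomy i j with hij | rfl | hij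
  · have hji : ¬ j < i := by omega
    have d3 := count_le_diff x hij.le
    by_cases h1 : x i <;> by_cases h2 : x j <;>
    unfold col rawcol pos <;> simp only [h1, h2, if_true, if_false, hij, hji, iff_self, not_true, not_false_eq_true, iff_true, iff_false, and_true, and_false, or_false, false_or]
    · have b1 := Nat.count_strict_mono h1 hij
      have b2 := Nat.count_strict_mono h2 hj
      split_ifs <;> omega
    · have b1 := Nat.count_strict_mono h1 hij
      have b2 := count_not_strict x h2 hj
      split_ifs <;> omega
    · have b1 := count_not_strict x h1 hij
      have b2 := Nat.count_strict_mono h2 hj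
      have b3 := Nat.count_monotone x hij.le
      split_ifs <;> omega
    · have b1 := count_not_strict x h1 hij
      have b2 := count_not_strict x h2 hj
      split_ifs <;> omega
  · by_cases h1 : x i <;>
    unfold col rawcol pos <;> simp only [h1, if_true, if_false, iff_self, not_true, not_false_eq_true, iff_true, iff_false]
    · have b1 := Nat.count_strict_mono h1 hi
      split_ifs <;> omega
    · have b1 := count_not_strict x h1 hi
      split_ifs <;> omega
  · have hji : ¬ i < j := by omega
    by_cases h1 : x i <;> by_cases h2 : x j <;>
    unfold col rawcol pos <;> simp only [h1, h2, if_true, if_false, hij, hji, iff_self, not_true, not_false_eq_true, iff_true, iff_false, and_true, and_false, or_false, false_or]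
    · have b1 := Nat.count_strict_mono h2 hij
      have b2 := Nat.count_strict_mono h1 hi
      split_ifs <;> omega
    · have b1 := count_not_strict x h2 hij
      have b2 := Nat.count_strict_mono h1 hi
      split_ifs <;> omega
    · have b1 := Nat.count_strict_mono h2 hij
      have b2 := count_not_strict x h1 hi
      split_ifs <;> omega
    · have b1 := count_not_strict x h2 hij
      have b2 := count_not_strict x h1 hi
      have b3 := Nat.count_monotone x hij.le
      split_ifs <;> omega

end JaegerAux
namespace JaegerAux

open Multigraph

variable {V E : Type}

lemma two_mem_unique (G : Multigraph V E) (hs : Function.Injective G.ends) {e f : E}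
    (hef : e ≠ f) {u v : V} (hue : u ∈ G.ends e) (huf : u ∈ G.ends f)
    (hve : v ∈ G.ends e) (hvf : v ∈ G.ends f) : u = v := by
  by_contra huv
  apply hef
  apply hs
  rw [(Sym2.mem_and_mem_iff huv).1 ⟨hue, hve⟩, (Sym2.mem_and_mem_iff huv).1 ⟨huf, hvf⟩]

/-- Solving the boundary equation modulo two on a connected multigraph. -/
lemma exists_boundary [Fintype V] [Fintype E] (G : Multigraph V E) (hconn : G.Connected)
    (g : V → ZMod 2) (hg : ∑ v, g v = 0) :
    ∃ J : E → ZMod 2, ∀ v, ∑ e, (if v ∈ G.ends e then J e else 0) = g v := by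
  obtain ⟨⟨root⟩, hc⟩ := hconn
  have key : ∀ w, Relation.ReflTransGen G.Adj root w → ∃ J : E → ZMod 2, ∀ v,
      ∑ e, (if v ∈ G.ends e then J e else 0)
        = (if v = w then 1 else 0) + (if v = root then 1 else 0) := by
    intro w hw
    induction hw with
    | refl =>
      refine ⟨fun _ => 0, fun v => ?_⟩
      simp only [ite_self, Finset.sum_const_zero]
      split_ifs <;> decide
    | @tail b c _ hbc ih =>
      obtain ⟨J, hJ⟩ := ih
      obtain ⟨g, hg⟩ := hbc
      have hne : b ≠ c := by
        intro h
        apply G.not_isDiag g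
        rw [hg, h]
        simp
      refine ⟨fun e => J e + if e = g then 1 else 0, fun v => ?_⟩
      have h1 : ∀ e, (if v ∈ G.ends e then (J e + if e = g then 1 else 0) else (0 : ZMod 2))
          = (if v ∈ G.ends e then J e else 0) +
            (if e = g then (if v ∈ G.ends g then 1 else 0) else 0) := by
        intro e
        by_cases he : e = g
        · subst he
          split_ifs <;> simp
        · simp [he]
      simp only [h1, Finset.sum_add_distrib, hJ]
      simp only [Finset.sum_ite_eq', Finset.mem_univ, if_true, hg, Sym2.mem_iff]
      have hnot : ¬ (v = b ∧ v = c) := fun h => hne (h.1.symm.trans h.2)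
      generalize (v = b) = P at *
      generalize (v = c) = Q at *
      generalize (v = root) = R at *
      by_cases h2 : P <;> by_cases h3 : Q <;> by_cases h4 : R <;>
        simp only [h2, h3, h4, if_true, if_false, or_true, or_self, or_false] at hnot ⊢ <;>
        first | decide | exact absurd ⟨trivial, trivial⟩ hnot
  choose J hJ using fun w => key w (hc root w)
  refine ⟨fun e => ∑ w, g w * J w e, fun v => ?_⟩
  have h1 : ∀ e, (if v ∈ G.ends e then ∑ w, g w * J w e else 0)
      = ∑ w, g w * (if v ∈ G.ends e then J w e else 0) := by
    intro e
    split_ifs <;> simp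
  simp only [h1]
  rw [Finset.sum_comm]
  simp only [← Finset.mul_sum, hJ, mul_add, Finset.sum_add_distrib]
  rw [← Finset.sum_mul, hg]
  simp

/-- An orientation of a connected multigraph with an even number of edges, with all
"in-degrees" even. -/
lemma exists_orientation [Fintype V] [Fintype E] (G : Multigraph V E) (hconn : G.Connected)
    (heven : Even (Fintype.card E)) :
    ∃ x : V → E → Prop, (∀ e u v, G.ends e = s(u, v) → (x u e ↔ ¬ x v e)) ∧
      ∀ v, Even (Finset.univ.filter (fun e => v ∈ G.ends e ∧ x v e)).card := by
  have hh : ∀ e, ∃ v, v ∈ G.ends e := fun e => ⟨_, Sym2.out_fst_mem _⟩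
  choose o ho using hh
  obtain ⟨J, hJ⟩ := exists_boundary G hconn
    (fun v => ∑ e, if o e = v then 1 else 0) (by
      rw [Finset.sum_comm]
      simp only [Finset.sum_ite_eq, Finset.mem_univ, if_true, Finset.sum_const, Finset.card_univ,
        nsmul_eq_mul, mul_one]
      exact (ZMod.natCast_eq_zero_iff_even).2 heven)
  have z2 : ∀ a : ZMod 2, a = 0 ∨ a = 1 := by decide
  refine ⟨fun v e => J e + (if o e = v then 1 else 0) = 1, ?_, ?_⟩
  · intro e u v he
    have hne : u ≠ v := by
      intro h
      apply G.not_isDiag e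
      rw [he, h]
      simp
    have := ho e
    rw [he, Sym2.mem_iff] at this
    rcases this with h | h
    · have h' : o e ≠ v := by rw [h]; exact hne
      simp only [h, if_true, hne, if_false]
      rcases z2 (J e) with h | h <;> rw [h] <;> decide
    · have h' : o e ≠ u := by rw [h]; exact hne.symm
      simp only [h, if_true, hne.symm, if_false]
      rcases z2 (J e) with h | h <;> rw [h] <;> decide
  · intro v
    rw [← ZMod.natCast_eq_zero_iff_even, Finset.natCast_card_filter]
    have h1 : ∀ e, (if v ∈ G.ends e ∧ J e + (if o e = v then 1 else 0) = 1 then (1 : ZMod 2) else 0)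
        = (if v ∈ G.ends e then J e else 0) + (if o e = v then 1 else 0) := by
      intro e
      by_cases hv : v ∈ G.ends e
      · simp only [hv, true_and, if_true]
        generalize J e + (if o e = v then (1 : ZMod 2) else 0) = a
        rcases z2 a with rfl | rfl <;> decide
      · have : o e ≠ v := by
          rintro rfl
          exact hv (ho e)
        simp [hv, this]
    refine (Finset.sum_congr rfl (fun e _ => ?_)).trans (?_ : ∑ e,
      ((if v ∈ G.ends e then J e else 0) + (if o e = v then (1 : ZMod 2) else 0)) = 0)
    · convert h1 e
    rw [Finset.sum_add_distrib, hJ]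
    generalize (∑ e, if o e = v then (1 : ZMod 2) else 0) = a
    rcases z2 a with rfl | rfl <;> decide

/-- A regular interval colourable multigraph is of class one. -/
lemma exists_class_one [Fintype E] (G : Multigraph V E) (r : ℕ) (hr : 2 ≤ r)
    (hreg : ∀ v : V, G.degree v = r) (hcol : G.IntervalColorable) :
    ∃ κ : E → ℕ, (∀ e, κ e < r) ∧ G.Proper κ := by
  obtain ⟨t, c, hp, -, -, hI⟩ := hcol
  refine ⟨fun e => c e % r, fun e => Nat.mod_lt _ (by omega), ?_⟩
  intro e f hef v hve hvf hmod
  obtain ⟨a, b, hab⟩ := hI v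
  have hcard : (G.colorSet c v).card = r := by
    unfold colorSet
    rw [Finset.card_image_of_injOn]
    · exact hreg v
    · intro e he f hf h
      by_contra hne
      simp only [Finset.coe_filter, Finset.mem_univ, true_and, Set.mem_ofPred_eq] at he hf
      exact hp e f hne v he hf h
  rw [hab, Nat.card_Icc] at hcard
  have he : c e ∈ Finset.Icc a b := by
    rw [← hab]; exact Finset.mem_image_of_mem _ (by simp [hve])
  have hf : c f ∈ Finset.Icc a b := by
    rw [← hab]; exact Finset.mem_image_of_mem _ (by simp [hvf])
  rw [Finset.mem_Icc] at he hf
  have hne := hp e f hef v hve hvf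
  have hmod' : c e ≡ c f [MOD r] := hmod
  rcases Nat.lt_or_gt_of_ne hne with h | h
  · have := (Nat.modEq_iff_dvd' h.le).1 hmod'
    have := Nat.le_of_dvd (by omega) this
    omega
  · have := (Nat.modEq_iff_dvd' h.le).1 hmod'.symm
    have := Nat.le_of_dvd (by omega) this
    omega

/-- Degrees in the line graph. -/
lemma lineGraph_degree [Fintype E] (G : Multigraph V E)
    (hs : Function.Injective G.ends) (r : ℕ)
    (hreg : ∀ v : V, G.degree v = r) (e : E) : G.lineGraph.degree e = 2 * (r - 1) := by
  obtain ⟨u, v, huv⟩ : ∃ u v, G.ends e = s(u, v) := by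
    induction h : G.ends e with | _ u v => exact ⟨u, v, rfl⟩
  have hne : u ≠ v := by
    intro h
    apply G.not_isDiag e
    rw [huv, h]
    simp
  have hu : u ∈ G.ends e := by rw [huv]; simp
  have hv : v ∈ G.ends e := by rw [huv]; simp
  let I : V → Finset E := fun w => (Finset.univ.filter (fun f => w ∈ G.ends f)).erase e
  have hI : ∀ w, w ∈ G.ends e → (I w).card = r - 1 := by
    intro w hw
    have := hreg w
    unfold Multigraph.degree at this
    rw [Finset.card_erase_of_mem (by simp [hw]), this]
  have hdisj : Disjoint (I u) (I v) := by
    rw [Finset.disjoint_left]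
    intro f hfu hfv
    simp only [I, Finset.mem_erase, Finset.mem_filter, Finset.mem_univ, true_and] at hfu hfv
    exact hne (two_mem_unique G hs hfu.1 hfu.2 hu hfv.2 hv)
  have himg : (Finset.univ.filter (fun p : G.LineEdges => e ∈ G.lineGraph.ends p)).image
      (fun p => p.1) = (I u ∪ I v).image (fun f => s(e, f)) := by
    ext p
    simp only [Finset.mem_image, Finset.mem_filter, Finset.mem_univ, true_and, Finset.mem_union,
      I, Finset.mem_erase]
    constructor
    · rintro ⟨⟨q, hq, w, hw⟩, hp, rfl⟩
      obtain ⟨f, rfl⟩ : ∃ f, q = s(e, f) := hp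
      have hfe : f ≠ e := by
        rintro rfl
        exact hq (by simp)
      have h1 := hw e (by simp)
      have h2 := hw f (by simp)
      rw [huv, Sym2.mem_iff] at h1
      refine ⟨f, ?_, rfl⟩
      rcases h1 with rfl | rfl
      · exact Or.inl ⟨hfe, h2⟩
      · exact Or.inr ⟨hfe, h2⟩
    · rintro ⟨f, hf, rfl⟩
      have : ∃ w, w ∈ G.ends e ∧ w ∈ G.ends f := by
        rcases hf with hf | hf
        · exact ⟨u, hu, hf.2⟩
        · exact ⟨v, hv, hf.2⟩
      obtain ⟨w, hwe, hwf⟩ := this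
      have hfe : f ≠ e := by
        rcases hf with hf | hf <;> exact hf.1
      refine ⟨⟨s(e, f), ?_, w, ?_⟩, ?_, rfl⟩
      · simpa using hfe.symm
      · intro g hg
        rw [Sym2.mem_iff] at hg
        rcases hg with rfl | rfl <;> assumption
      · simp [lineGraph]
  unfold Multigraph.degree
  have hinj : Function.Injective (fun p : G.LineEdges => p.1) := Subtype.val_injective
  have hc := Finset.card_image_of_injective
    (Finset.univ.filter (fun p : G.LineEdges => e ∈ G.lineGraph.ends p)) hinj
  rw [← hc, himg, Finset.card_image_of_injective,
    Finset.card_union_of_disjoint hdisj, hI u hu, hI v hv]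
  · omega
  · intro a b h
    exact Sym2.congr_right.1 h

lemma card_lineEdges [Fintype E] (G : Multigraph V E)
    (hs : Function.Injective G.ends) (r : ℕ)
    (hreg : ∀ v : V, G.degree v = r) :
    Fintype.card G.LineEdges = Fintype.card E * (r - 1) := by
  have h1 : ∑ e : E, G.lineGraph.degree e = ∑ p : G.LineEdges, 2 := by
    unfold Multigraph.degree
    simp only [Finset.card_filter]
    rw [Finset.sum_comm]
    apply Finset.sum_congr rfl
    intro p _
    rw [← Finset.card_filter, ← Sym2.card_toFinset_of_not_isDiag _ (G.lineGraph.not_isDiag p)]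
    congr 1
    ext e
    simp
  simp only [lineGraph_degree G hs r hreg, Finset.sum_const, Finset.card_univ, smul_eq_mul] at h1
  have : 2 * Fintype.card G.LineEdges = 2 * (Fintype.card E * (r - 1)) := by
    rw [mul_comm, ← h1]; ring
  omega

lemma lineGraph_connected [Fintype E] (G : Multigraph V E) (hconn : G.Connected) (r : ℕ)
    (hr : 2 ≤ r) (hreg : ∀ v : V, G.degree v = r) : G.lineGraph.Connected := by
  obtain ⟨⟨root⟩, hc⟩ := hconn
  have share : ∀ e f v, v ∈ G.ends e → v ∈ G.ends f →
      Relation.ReflTransGen G.lineGraph.Adj e f := by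
    intro e f v he hf
    by_cases h : e = f
    · rw [h]
    · apply Relation.ReflTransGen.single
      refine ⟨⟨s(e, f), by simpa using h, v, ?_⟩, rfl⟩
      intro g hg
      rw [Sym2.mem_iff] at hg
      rcases hg with rfl | rfl <;> assumption
  refine ⟨?_, ?_⟩
  · have h := hreg root
    unfold Multigraph.degree at h
    obtain ⟨e, -⟩ := Finset.card_pos.1 (by rw [h]; omega)
    exact ⟨e⟩
  · intro e f
    have hw := hc (Quot.out (G.ends e)).1 (Quot.out (G.ends f)).1
    have he : (Quot.out (G.ends e)).1 ∈ G.ends e := Sym2.out_fst_mem _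
    have hf : (Quot.out (G.ends f)).1 ∈ G.ends f := Sym2.out_fst_mem _
    generalize (Quot.out (G.ends e)).1 = a at *
    generalize (Quot.out (G.ends f)).1 = b at *
    induction hw generalizing f with
    | refl => exact share e f a he hf
    | @tail b c _ hbc ih =>
      obtain ⟨g, hg⟩ := hbc
      exact (ih g (by rw [hg]; simp)).trans (share g f c (by rw [hg]; simp) hf)

end JaegerAux
namespace JaegerAux

open Multigraph

variable {V E : Type}

/-- Jaeger's theorem together with the (easy) regular case of Asratian and Kamalian. -/
lemma lineGraph_intervalColorable [Fintype V] [Fintype E] (G : Multigraph V E)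
    (hs : Function.Injective G.ends) (hconn : G.Connected) (r : ℕ) (hr : 2 ≤ r)
    (hreg : ∀ v : V, G.degree v = r) (heven : Even (Fintype.card E))
    (hcol : G.IntervalColorable) : G.lineGraph.IntervalColorable := by
  obtain ⟨κ, hκ, hprop⟩ := exists_class_one G r hr hreg hcol
  obtain ⟨x, hx, hxe⟩ := exists_orientation G hconn heven
  obtain ⟨N, rfl⟩ : ∃ N, r = N + 1 := ⟨r - 1, by omega⟩
  have hinj : ∀ {e f v}, v ∈ G.ends e → v ∈ G.ends f → κ e = κ f → e = f := by
    intro e f v he hf h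
    by_contra hne
    exact hprop e f hne v he hf h
  obtain ⟨xb, xb_def⟩ : ∃ xb : V → ℕ → Prop,
      ∀ v k, xb v k ↔ ∃ e, v ∈ G.ends e ∧ κ e = k ∧ x v e := ⟨_, fun _ _ => Iff.rfl⟩
  have hxb : ∀ {e v}, v ∈ G.ends e → (xb v (κ e) ↔ x v e) := by
    intro e v he
    rw [xb_def]
    constructor
    · rintro ⟨f, hf, hk, hxf⟩
      rwa [hinj hf he hk] at hxf
    · intro h
      exact ⟨e, he, rfl, h⟩
  have hpar : ∀ v, Even (Nat.count (xb v) (N + 1)) := by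
    intro v
    have h : (Finset.range (N + 1)).filter (xb v)
        = (Finset.univ.filter (fun e => v ∈ G.ends e ∧ x v e)).image κ := by
      ext k
      simp only [Finset.mem_filter, Finset.mem_range, Finset.mem_image, Finset.mem_univ, true_and,
        xb_def]
      constructor
      · rintro ⟨-, e, he, hk, hxe⟩
        exact ⟨e, ⟨he, hxe⟩, hk⟩
      · rintro ⟨e, ⟨he, hxe⟩, rfl⟩
        exact ⟨hκ e, e, he, rfl, hxe⟩
    rw [Nat.count_eq_card_filter_range, h, Finset.card_image_of_injOn]
    · exact hxe v
    · intro e he f hf hef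
      simp only [Finset.coe_filter, Finset.mem_univ, true_and, Set.mem_ofPred_eq] at he hf
      exact hinj he.1 hf.1 hef
  let F : V → E → E → ℕ := fun v e f =>
    if κ e = N then col N (xb v) (κ f) (κ f)
    else if κ f = N then col N (xb v) (κ e) (κ e) else col N (xb v) (κ e) (κ f)
  have Fsymm : ∀ v e f, F v e f = F v f e := by
    intro v e f
    simp only [F]
    by_cases h1 : κ e = N <;> by_cases h2 : κ f = N <;> simp only [h1, h2, if_true, if_false]
    exact col_symm _ _ _ _
  have Flt : ∀ {v e f}, e ≠ f → v ∈ G.ends e → v ∈ G.ends f → F v e f < 2 * N := by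
    intro v e f hef he hf
    have h0 : κ e ≠ κ f := fun h => hef (hinj he hf h)
    have h1 := hκ e
    have h2 := hκ f
    simp only [F]
    split_ifs with h3 h4
    · exact col_lt _ _ (by omega) (by omega)
    · exact col_lt _ _ (by omega) (by omega)
    · exact col_lt _ _ (by omega) (by omega)
  have Finj : ∀ {v e f g}, e ≠ f → e ≠ g → v ∈ G.ends e → v ∈ G.ends f → v ∈ G.ends g →
      F v e f = F v e g → f = g := by
    intro v e f g hef heg he hf hg h
    have h0 : κ e ≠ κ f := fun h => hef (hinj he hf h)
    have h0' : κ e ≠ κ g := fun h => heg (hinj he hg h)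
    have h1 := hκ e
    have h2 := hκ f
    have h3 := hκ g
    apply hinj hf hg
    simp only [F] at h
    split_ifs at h with h4 h5 h6 h6
    · exact col_diag_inj N _ (by omega) (by omega) h
    · omega
    · exact absurd (col_inj N _ (by omega) (by omega) h) h0'
    · exact absurd (col_inj N _ (by omega) (by omega) h).symm h0
    · exact col_inj N _ (by omega) (by omega) h
  have Fdiff : ∀ {u v e f g}, e ≠ f → e ≠ g → G.ends e = s(u, v) → u ∈ G.ends f →
      v ∈ G.ends g → F u e f ≠ F v e g := by
    intro u v e f g hef heg he hf hg h
    have hu : u ∈ G.ends e := by rw [he]; simp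
    have hv : v ∈ G.ends e := by rw [he]; simp
    have h0 : κ e ≠ κ f := fun h => hef (hinj hu hf h)
    have h0' : κ e ≠ κ g := fun h => heg (hinj hv hg h)
    have h1 := hκ e
    have h2 := hκ f
    have h3 := hκ g
    have hflip : xb u (κ e) ↔ ¬ xb v (κ e) := by
      rw [hxb hu, hxb hv]; exact hx e u v he
    by_cases h4 : κ e = N
    · simp only [F, h4, if_true] at h
      have p1 := col_diag N (xb u) (κ f)
      have p2 := col_diag N (xb v) (κ g)
      have q1 := hpar u
      have q2 := hpar v
      rw [Nat.count_succ, Nat.even_iff] at q1 q2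
      rw [h4] at hflip
      by_cases h5 : xb v N
      · have h6 : ¬ xb u N := fun h => hflip.1 h h5
        rw [if_neg h6] at q1
        rw [if_pos h5] at q2
        omega
      · have h6 : xb u N := hflip.2 h5
        rw [if_pos h6] at q1
        rw [if_neg h5] at q2
        omega
    · have aux : ∀ w k, κ k < N + 1 → ((κ e ≤ F w e k ∧ F w e k < κ e + N) ↔ ¬ xb w (κ e)) := by
        intro w k hk
        simp only [F, h4, if_false]
        split_ifs with h5
        · exact col_mem N _ (by omega) (by omega)
        · exact col_mem N _ (by omega) (by omega)
      have a1 := aux u f h2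
      have a2 := aux v g h3
      rw [h] at a1
      by_cases h5 : xb v (κ e)
      · have h6 : ¬ xb u (κ e) := fun h => hflip.1 h h5
        exact a2.1 (a1.2 h6) h5
      · exact a1.1 (a2.2 h5) (hflip.2 h5)
  have hdata : ∀ p : G.LineEdges, ∃ (e f : E) (v : V), p.1 = s(e, f) ∧ e ≠ f ∧ v ∈ G.ends e ∧
      v ∈ G.ends f := by
    rintro ⟨p, hp, v, hv⟩
    induction p with | _ e f =>
    exact ⟨e, f, v, rfl, by simpa using hp, hv e (by simp), hv f (by simp)⟩
  choose pe pf pv hp hpne hpe hpf using hdata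
  let C : G.LineEdges → ℕ := fun p => F (pv p) (pe p) (pf p) + 1
  have hC : ∀ (p : G.LineEdges) (e : E), e ∈ p.1 → ∃ f v, p.1 = s(e, f) ∧ e ≠ f ∧ v ∈ G.ends e ∧
      v ∈ G.ends f ∧ C p = F v e f + 1 := by
    intro p e he
    rw [hp p, Sym2.mem_iff] at he
    rcases he with rfl | rfl
    · exact ⟨pf p, pv p, hp p, hpne p, hpe p, hpf p, rfl⟩
    · refine ⟨pe p, pv p, (hp p).trans Sym2.eq_swap, (hpne p).symm, hpf p, hpe p, ?_⟩
      simp only [C]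
      rw [Fsymm]
  have hCproper : G.lineGraph.Proper C := by
    intro p q hpq e hep heq hCC
    obtain ⟨f, u, hpf', hef, hue, huf, hCp⟩ := hC p e hep
    obtain ⟨g, v, hqg, heg, hve, hvg, hCq⟩ := hC q e heq
    have hF : F u e f = F v e g := by omega
    by_cases huv : u = v
    · subst huv
      have := Finj hef heg hue huf hvg hF
      apply hpq
      apply Subtype.ext
      rw [hpf', hqg, this]
    · exact Fdiff hef heg ((Sym2.mem_and_mem_iff huv).1 ⟨hue, hve⟩) huf hvg hF
  have hCmem : ∀ p, C p ∈ Finset.Icc 1 (2 * N) := by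
    intro p
    have := Flt (hpne p) (hpe p) (hpf p)
    simp only [C, Finset.mem_Icc]
    omega
  have hset : ∀ e, G.lineGraph.colorSet C e = Finset.Icc 1 (2 * N) := by
    intro e
    apply Finset.eq_of_subset_of_card_le
    · intro k hk
      obtain ⟨p, -, rfl⟩ := Finset.mem_image.1 hk
      exact hCmem p
    · have hd := lineGraph_degree G hs (N + 1) hreg e
      unfold Multigraph.degree at hd
      unfold colorSet
      rw [Finset.card_image_of_injOn, hd, Nat.card_Icc]
      · omega
      · intro p h1 q h2 h
        by_contra hne
        simp only [Finset.coe_filter, Finset.mem_univ, true_and, Set.mem_ofPred_eq] at h1 h2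
        exact hCproper p q hne e h1 h2 h
  refine ⟨2 * N, C, hCproper, hCmem, ?_, fun e => ⟨1, 2 * N, hset e⟩⟩
  intro i hi
  obtain ⟨⟨e⟩, -⟩ := lineGraph_connected G hconn (N + 1) hr hreg
  rw [← hset e] at hi
  obtain ⟨p, -, h⟩ := Finset.mem_image.1 hi
  exact ⟨p, h⟩

end JaegerAux

/-- if `G` is a connected `r`-regular simple graph (`r ≥ 2`) with an even
number of edges that is interval colorable, then `L(G)` is a connected Eulerian graph
with an even number of edges that is interval colorable. -/
theorem stmt14 {V E : Type} [Fintype V] [Fintype E] (G : Multigraph V E)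
    (hsimple : Function.Injective G.ends) (hconn : G.Connected) (r : ℕ) (hr : 2 ≤ r)
    (hreg : ∀ v : V, G.degree v = r) (heven : Even (Fintype.card E))
    (hcol : G.IntervalColorable) :
    G.lineGraph.Connected ∧ (∀ f : E, Even (G.lineGraph.degree f)) ∧
      Even (Fintype.card G.LineEdges) ∧ G.lineGraph.IntervalColorable := by
  refine ⟨JaegerAux.lineGraph_connected G hconn r hr hreg, fun f => ?_, ?_,
    JaegerAux.lineGraph_intervalColorable G hsimple hconn r hr hreg heven hcol⟩
  · rw [JaegerAux.lineGraph_degree G hsimple r hreg f]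
    exact even_two_mul _
  · rw [JaegerAux.card_lineEdges G hsimple r hreg]
    exact heven.mul_right _
end
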